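/- In any execution of the AGS coding scheme Π (Algorithms 3–4) on inputs (x,y): let i be a round in which Alice has not yet terminated and Bob has not entered the termination phase. If no timestep of round i is erased, then r_A(i+1) = r_A(i)+1, except possibly in the case where r_A(i) = r_B(i) and the second timestep of round i−1 was erased. -/

import Mathlib

/-!
Model of the AGS coding scheme Π (Algorithms 3–4) of "Interactive coding resilient to
an unknown number of erasures".  A noiseless alternating binary protocol `π` of length
`N` is given by next-bit functions `fA fB : List Bool → Bool` (`fA t = π(x∣t)` on
even-length transcripts, `fB t = π(y∣t)` on odd-length transcripts).
Rounds are 1-indexed; round `i` consists of two timesteps whose erasures are given by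
`(E i).1` (odd timestep, Alice → Bob) and `(E i).2` (even timestep, Bob → Alice).
In each timestep the sender either transmits a symbol `(b, ρ) ∈ {0,1}×{0,1}` or stays
silent (`□`); a reception is `none` (= the erasure mark ⊥) or `some` of a symbol.
-/

namespace AGS

/-- A transmitted symbol: a message `(bit, parity)`, or silence `□`. -/
inductive Sym where
  | msg : Bool → Bool → Sym
  | sil : Sym
deriving DecidableEq

/-- The word (information-bit content) of a symbol: one bit for a message, the empty
word for silence. -/
def symWord : Sym → List Bool
  | Sym.msg b _ => [b]
  | Sym.sil => []

/-- Parity of a round number, as a Boolean. -/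
def par (r : ℕ) : Bool := decide (r % 2 = 1)

/-- Joint state at the beginning of a round: Alice's transcript `TA`, counter `rA`,
flag `abot` (her last reception was ⊥); Bob's transcript `TB`, counter `rB`, and
stored bit `bsend`. -/
structure St where
  TA : List Bool
  rA : ℕ
  abot : Bool
  TB : List Bool
  rB : ℕ
  bsend : Bool
deriving DecidableEq

/-- The initial state. -/
def init : St := ⟨[], 0, false, [], 0, false⟩

/-- The symbol Alice sends in the odd timestep of a round (silence if her last
reception was erased, and implicit silence after she has terminated). -/
def sentA (fA : List Bool → Bool) (N : ℕ) (s : St) : Sym :=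
  if s.rA < N / 2 then
    if s.abot then Sym.sil else Sym.msg (fA s.TA) (par (s.rA + 1))
  else Sym.sil

/-- Bob's reception in the odd timestep (`none` = erasure mark ⊥). -/
def recvB (fA : List Bool → Bool) (N : ℕ) (e1 : Bool) (s : St) : Option Sym :=
  if e1 then none else some (sentA fA N s)

/-- Bob's update of `TB, rB, bsend` in the odd timestep, given his reception. -/
def bobUpd (fB : List Bool → Bool) (N : ℕ) (r : Option Sym) (s : St) : St :=
  if s.rB < N / 2 then
    match r with
    | some (Sym.msg b p) =>
        if p = par (s.rB + 1) then
          { s with rB := s.rB + 1, bsend := fB (s.TB ++ [b]),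
                   TB := (s.TB ++ [b]) ++ [fB (s.TB ++ [b])] }
        else s
    | _ => s
  else s

/-- The symbol Bob sends in the even timestep of a round, given the erasure `e1` of
the odd timestep and the state `s` at the beginning of the round.  In the normal
phase (`rB < N/2`) he answers any non-⊥ reception with his (possibly just updated)
stored message and is silent upon ⊥; in the termination phase (`rB = N/2`) he answers
only a non-silent message of matching parity, and is silent otherwise. -/
def sentB (fA fB : List Bool → Bool) (N : ℕ) (e1 : Bool) (s : St) : Sym :=
  let r := recvB fA N e1 s
  if s.rB < N / 2 then
    match r with
    | none => Sym.sil
    | some _ =>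
        let s' := bobUpd fB N r s
        Sym.msg s'.bsend (par s'.rB)
  else
    match r with
    | some (Sym.msg _ p) => if p = par s.rB then Sym.msg s.bsend (par s.rB) else Sym.sil
    | _ => Sym.sil

/-- One round of the AGS coding scheme.  After Alice terminates (`rA = N/2`) her part
of the state is frozen and only Bob's part evolves (he keeps receiving silence, unless
erased). -/
def step (fA fB : List Bool → Bool) (N : ℕ) (e : Bool × Bool) (s : St) : St :=
  let r := recvB fA N e.1 s
  let sB := bobUpd fB N r s
  if s.rA < N / 2 then
    let mB := sentB fA fB N e.1 s
    let rcvA : Option Sym := if e.2 then none else some mB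
    match rcvA with
    | none => { sB with rA := s.rA, abot := true }
    | some (Sym.msg b p) =>
        if p = par (s.rA + 1) then
          { sB with TA := (s.TA ++ [fA s.TA]) ++ [b], rA := s.rA + 1, abot := false }
        else { sB with rA := s.rA, abot := false }
    | some Sym.sil => { sB with rA := s.rA, abot := false }
  else sB

/-- `exec fA fB N E k` is the state after `k` rounds have been played. -/
def exec (fA fB : List Bool → Bool) (N : ℕ) (E : ℕ → Bool × Bool) : ℕ → St
  | 0 => init
  | k + 1 => step fA fB N (E (k + 1)) (exec fA fB N E k)

/-- `stAt fA fB N E i` is the state at the beginning of round `i` (rounds 1-indexed):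
for a protocol variable `v`, `v(i) = (stAt … i).v`. -/
def stAt (fA fB : List Bool → Bool) (N : ℕ) (E : ℕ → Bool × Bool) (i : ℕ) : St :=
  exec fA fB N E (i - 1)

/-- The noiseless transcript of `π` after `r` rounds; `transcript fA fB (N/2)` is `T^π`. -/
def transcript (fA fB : List Bool → Bool) : ℕ → List Bool
  | 0 => []
  | r + 1 =>
    let t := transcript fA fB r
    (t ++ [fA t]) ++ [fB (t ++ [fA t])]

/-- `cA … i` : the number of rounds `j < i` in which Alice sent a non-silent message. -/
def cA (fA fB : List Bool → Bool) (N : ℕ) (E : ℕ → Bool × Bool) (i : ℕ) : ℕ :=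
  ((Finset.Ico 1 i).filter fun j => sentA fA N (stAt fA fB N E j) ≠ Sym.sil).card

/-- `cB … i` : the number of rounds `j < i` in which Bob sent a non-silent message. -/
def cB (fA fB : List Bool → Bool) (N : ℕ) (E : ℕ → Bool × Bool) (i : ℕ) : ℕ :=
  ((Finset.Ico 1 i).filter fun j =>
    sentB fA fB N (E j).1 (stAt fA fB N E j) ≠ Sym.sil).card

/-- `cch … i` : the total number of ⊥ receptions of Bob and of Alice in the rounds
before round `i` (Alice receives only while she is active). -/
def cch (fA fB : List Bool → Bool) (N : ℕ) (E : ℕ → Bool × Bool) (i : ℕ) : ℕ :=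
  ((Finset.Ico 1 i).filter fun j => (E j).1 = true).card +
  ((Finset.Ico 1 i).filter fun j =>
    (E j).2 = true ∧ (stAt fA fB N E j).rA < N / 2).card

theorem par_succ_ne (n : ℕ) : par (n + 1) ≠ par n := by
  simp only [par, ne_eq, decide_eq_decide]
  omega

theorem bobUpd_rA (fB : List Bool → Bool) (N : ℕ) (r : Option Sym) (s : St) :
    (bobUpd fB N r s).rA = s.rA := by
  unfold bobUpd
  split_ifs
  · split
    · split_ifs <;> rfl
    · rfl
  · rfl

/-- Bob's counter is level with Alice's or one ahead of it, and one round preserves this. -/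
theorem step_counters (fA fB : List Bool → Bool) (N : ℕ) (e : Bool × Bool) (s : St)
    (h : s.rB = s.rA ∨ s.rB = s.rA + 1) :
    (step fA fB N e s).rB = (step fA fB N e s).rA ∨
      (step fA fB N e s).rB = (step fA fB N e s).rA + 1 := by
  obtain ⟨TA, rA, abot, TB, rB, bsend⟩ := s
  obtain ⟨e₁, e₂⟩ := e
  have hp := par_succ_ne rA
  have hp' := par_succ_ne (rA + 1)
  dsimp only at h
  by_cases hA : rA < N / 2
  · rcases h with rfl | rfl
    · cases e₁ <;> cases e₂ <;> cases abot <;>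
        simp [step, recvB, sentA, bobUpd, sentB, hA, hp.symm]
    · by_cases hB : rA + 1 < N / 2 <;> cases e₁ <;> cases e₂ <;> cases abot <;>
        simp [step, recvB, sentA, bobUpd, sentB, hA, hB, hp'.symm]
  · cases e₁ <;> simp [step, recvB, sentA, bobUpd, hA, h]

theorem exec_counters (fA fB : List Bool → Bool) (N : ℕ) (E : ℕ → Bool × Bool) (k : ℕ) :
    (exec fA fB N E k).rB = (exec fA fB N E k).rA ∨
      (exec fA fB N E k).rB = (exec fA fB N E k).rA + 1 := by
  induction k with
  | zero => exact Or.inl rfl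
  | succ k ih => exact step_counters fA fB N _ _ ih

/-- After a round at whose end Alice is still active, her flag records whether the even
timestep was erased. -/
theorem step_abot (fA fB : List Bool → Bool) (N : ℕ) (e : Bool × Bool) (s : St)
    (h : (step fA fB N e s).rA < N / 2) : (step fA fB N e s).abot = e.2 := by
  by_cases hA : s.rA < N / 2
  · obtain ⟨e₁, e₂⟩ := e
    cases e₂
    · simp only [step, hA, if_true, Bool.false_eq_true, if_false]
      split
      · simp_all
      · split_ifs <;> rfl
      · rfl
    · simp [step, hA]
  · simp [step, hA, bobUpd_rA] at h

/-- An erasure-free round advances Alice's counter unless the counters are level and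
Alice's last reception was erased. -/
theorem step_rA_of_no_erasure (fA fB : List Bool → Bool) (N : ℕ) (s : St)
    (hA : s.rA < N / 2) (hB : s.rB < N / 2) (h : s.rB = s.rA ∨ s.rB = s.rA + 1)
    (hs : s.rA = s.rB → s.abot = false) :
    (step fA fB N (false, false) s).rA = s.rA + 1 := by
  obtain ⟨TA, rA, abot, TB, rB, bsend⟩ := s
  have hp' := par_succ_ne (rA + 1)
  dsimp only at hA hB h hs
  rcases h with rfl | rfl
  · simp [step, recvB, sentA, bobUpd, sentB, hA, hs rfl]
  · cases abot <;> simp [step, recvB, sentA, bobUpd, sentB, hA, hB, hp'.symm]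

/-- Corollary 16 of the paper.  In any execution of the AGS scheme,
if at round `i` Alice has not yet terminated (`r_A(i) < N/2`) and Bob has not entered
the termination phase (`r_B(i) < N/2`), and no timestep of round `i` is erased, then
`r_A(i+1) = r_A(i) + 1`, except possibly when `r_A(i) = r_B(i)` and the second
timestep of round `i−1` was erased. -/
theorem ags_progress_one_round
    (fA fB : List Bool → Bool) (N : ℕ) (hN : 0 < N) (hNeven : Even N)
    (E : ℕ → Bool × Bool)
    (i : ℕ) (hi : 1 ≤ i)
    (hAactive : (stAt fA fB N E i).rA < N / 2)
    (hBactive : (stAt fA fB N E i).rB < N / 2)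
    (hE : E i = (false, false)) :
    (stAt fA fB N E (i + 1)).rA = (stAt fA fB N E i).rA + 1 ∨
    (2 ≤ i ∧ (stAt fA fB N E i).rA = (stAt fA fB N E i).rB ∧ (E (i - 1)).2 = true) := by
  obtain ⟨k, rfl⟩ : ∃ k, i = k + 1 := ⟨i - 1, by omega⟩
  simp only [stAt, Nat.add_sub_cancel] at hAactive hBactive ⊢
  rw [or_iff_not_imp_right]
  intro hexc
  rw [exec, hE]
  refine step_rA_of_no_erasure fA fB N _ hAactive hBactive (exec_counters fA fB N E k) ?_
  intro heq
  cases k with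
  | zero => rfl
  | succ k =>
    rw [exec, step_abot fA fB N _ _ hAactive]
    by_contra h
    exact hexc ⟨by omega, heq, by simpa using h⟩

end AGS
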